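/- (Relation R1 of the intermediate Wakimoto realization.) For all 1 ≤ i, j ≤ n and all m, p ∈ ℤ, [ρ(H_i)_m, ρ(H_j)_p] = (α_i|α_j) · (γ² − (r+1)) · m · δ_{m+p,0} · id as linear operators on ℂ[x] ⊗ ℂ[y]. -/

import Mathlib

open MvPolynomial

/-- The Cartan matrix of `sl(n+1, ℂ)` (indices `0, …, n-1` represent `1, …, n`). -/
def cartan (n : ℕ) (i j : Fin n) : ℤ :=
  if i = j then 2 else if (i : ℕ) + 1 = (j : ℕ) ∨ (j : ℕ) + 1 = (i : ℕ) then -1 else 0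

/-- The pairing `(α_i | α_{kl}) = Σ_{s=k}^{l} A_{is}` of a simple root with the positive
root `α_k + ⋯ + α_l`. -/
def pairRoot (n : ℕ) (i k l : Fin n) : ℤ :=
  ∑ s ∈ Finset.Icc k l, cartan n i s

/-- The matrix `𝔅_{ij} = (α_i|α_j)(γ² − δ_{i>r}δ_{j>r}(r+1) + (r/2)δ_{i,r+1}δ_{j,r+1})`. -/
noncomputable def Bmat (n r : ℕ) (γ : ℂ) (i j : Fin n) : ℂ :=
  (cartan n i j : ℂ) *
    (γ ^ 2 - (if r < (i : ℕ) + 1 ∧ r < (j : ℕ) + 1 then (r : ℂ) + 1 else 0)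
      + (if (i : ℕ) = r ∧ (j : ℕ) = r then (r : ℂ) / 2 else 0))

/-- Index type for the variables of `ℂ[x] ⊗ ℂ[y] ≅ ℂ[x, y]`:  left summands index the
variables `x_{ij,m}` (`1 ≤ i ≤ j ≤ n`, `m ∈ ℤ`; only indices with `i ≤ j` are used),
right summands index the variables `y_{i,m}` (`1 ≤ i ≤ n`, `m ≥ 1`). -/
abbrev Idx (n : ℕ) := (Fin n × Fin n × ℤ) ⊕ (Fin n × ℕ+)

/-- The Fock space `ℂ[x] ⊗ ℂ[y]`, realized as a polynomial ring in both families of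
variables. -/
abbrev PXY (n : ℕ) := MvPolynomial (Idx n) ℂ

/-- The oscillator operator `a_{ij,m} ⊗ 1`. -/
noncomputable def aOp (n r : ℕ) (i j : Fin n) (m : ℤ) : Module.End ℂ (PXY n) :=
  if 0 ≤ m ∧ (j : ℕ) + 1 ≤ r then (pderiv (Sum.inl (i, j, m))).toLinearMap
  else LinearMap.mulLeft ℂ (X (Sum.inl (i, j, m)))

/-- The oscillator operator `a*_{ij,m} ⊗ 1`. -/
noncomputable def aStar (n r : ℕ) (i j : Fin n) (m : ℤ) : Module.End ℂ (PXY n) :=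
  if m ≤ 0 ∧ (j : ℕ) + 1 ≤ r then LinearMap.mulLeft ℂ (X (Sum.inl (i, j, -m)))
  else - (pderiv (Sum.inl (i, j, -m))).toLinearMap

/-- The Heisenberg operator `1 ⊗ b_{i,m}`. -/
noncomputable def bOp (n : ℕ) (e : Fin n → Fin n → ℂ) (lam : Fin n → ℂ)
    (i : Fin n) (m : ℤ) : Module.End ℂ (PXY n) :=
  if hm : 0 < m then
    (m : ℂ) • ∑ k : Fin n, e i k • (pderiv (Sum.inr (k, (⟨m.toNat, by omega⟩ : ℕ+)))).toLinearMap
  else if hm' : m < 0 then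
    ∑ k : Fin n, e i k • LinearMap.mulLeft ℂ (X (Sum.inr (k, (⟨(-m).toNat, by omega⟩ : ℕ+))))
  else lam i • (1 : Module.End ℂ (PXY n))

/-- The normally ordered quadratic operator `N_{kl,m} = Σ_{q∈ℤ} :a_{kl,q} a*_{kl,m-q}:`
(pointwise `finsum`). -/
noncomputable def Nop (n r : ℕ) (k l : Fin n) (m : ℤ) (P : PXY n) : PXY n :=
  ∑ᶠ q : ℤ,
    if 0 ≤ q ∧ (l : ℕ) + 1 ≤ r then aStar n r k l (m - q) (aOp n r k l q P)
    else aOp n r k l q (aStar n r k l (m - q) P)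

/-- The operator `ℋ_{i,m} = Σ_{1 ≤ k ≤ l ≤ n} (α_i|α_{kl}) N_{kl,m}`. -/
noncomputable def Hcal (n r : ℕ) (i : Fin n) (m : ℤ) (P : PXY n) : PXY n :=
  ∑ k : Fin n, ∑ l : Fin n,
    if k ≤ l then (pairRoot n i k l : ℂ) • Nop n r k l m P else 0

/-- The quadratic operator `(a_{kl} a*_{k'l'})_m = Σ_{q∈ℤ} a_{kl,q} a*_{k'l',m-q}`. -/
noncomputable def pairOp (n r : ℕ) (k l k' l' : Fin n) (m : ℤ) (P : PXY n) : PXY n :=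
  ∑ᶠ q : ℤ, aOp n r k l q (aStar n r k' l' (m - q) P)

/-- `Σ_{k=1}^{i-1} (a_{k,i-1} a*_{k,i})_m`. -/
noncomputable def sumLow (n r : ℕ) (i : Fin n) (m : ℤ) (P : PXY n) : PXY n :=
  ∑ k : Fin n, if h : k < i then
    pairOp n r k (⟨(i : ℕ) - 1, by have := i.isLt; omega⟩ : Fin n) k i m P
  else 0

/-- `Σ_{k=i+1}^{n} (a_{i+1,k} a*_{i,k})_m`. -/
noncomputable def sumHigh (n r : ℕ) (i : Fin n) (m : ℤ) (P : PXY n) : PXY n :=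
  ∑ k : Fin n, if h : i < k then
    pairOp n r (⟨(i : ℕ) + 1, by have := k.isLt; have := Fin.lt_def.mp h; omega⟩ : Fin n)
      k i k m P
  else 0

/-- `Σ_{j=i+1}^{n} (a_{i,j} a*_{i+1,j})_m`, the quadratic part of `ρ(F_i)_m`. -/
noncomputable def sumF (n r : ℕ) (i : Fin n) (m : ℤ) (P : PXY n) : PXY n :=
  ∑ j : Fin n, if h : i < j then
    pairOp n r i j (⟨(i : ℕ) + 1, by have := j.isLt; have := Fin.lt_def.mp h; omega⟩ : Fin n)
      j m P
  else 0

/-- `a_{jl,q}` is an annihilation operator iff `q ≥ 0` and `l ≤ r`. -/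
def annAFlag (r : ℕ) {n : ℕ} (l : Fin n) (q : ℤ) : Bool :=
  decide (0 ≤ q ∧ (l : ℕ) + 1 ≤ r)

/-- `a*_{jl,q}` is an annihilation operator iff `q > 0` or `l > r`. -/
def annSFlag (r : ℕ) {n : ℕ} (l : Fin n) (q : ℤ) : Bool :=
  ! decide (q ≤ 0 ∧ (l : ℕ) + 1 ≤ r)

/-- Normally ordered product of three operators (each tagged with its annihilation flag):
annihilation operators are placed to the right of creation operators. -/
noncomputable def nord3 {n : ℕ} (f1 f2 f3 : Module.End ℂ (PXY n) × Bool) :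
    Module.End ℂ (PXY n) :=
  (([f1, f2, f3].filter fun p => !p.2).map Prod.fst).prod *
    (([f1, f2, f3].filter fun p => p.2).map Prod.fst).prod

/-- The mode of `:a*_{ii}(z) a_{kl}(z) a*_{kl}(z):` of `z`-degree `-m-1`. -/
noncomputable def cubic (n r : ℕ) (i k l : Fin n) (m : ℤ) (P : PXY n) : PXY n :=
  ∑ᶠ q : ℤ × ℤ,
    nord3 (aStar n r i i q.1, annSFlag r i q.1)
      (aOp n r k l q.2, annAFlag r l q.2)
      (aStar n r k l (m - q.1 - q.2), annSFlag r l (m - q.1 - q.2)) P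

/-- The mode `ρ(E_i)_m`, the coefficient of `z^{-m-1}` in
`E_i(z) = :a*_{ii}(Σ_{k<i} a_{k,i-1}a*_{k,i-1} − Σ_{k≤i} a_{ki}a*_{ki}):
+ Σ_{k>i} a_{i+1,k}a*_{ik} − Σ_{k<i} a_{k,i-1}a*_{ki} − a*_{ii} b_i
− (δ_{i>r}(r+1) + δ_{i≤r}(i+1) − γ²) ∂a*_{ii}`. -/
noncomputable def rhoE (n r : ℕ) (γ : ℂ) (e : Fin n → Fin n → ℂ) (lam : Fin n → ℂ)
    (i : Fin n) (m : ℤ) (P : PXY n) : PXY n :=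
  (∑ k : Fin n, if h : k < i then
      cubic n r i k (⟨(i : ℕ) - 1, by have := i.isLt; omega⟩ : Fin n) m P
    else 0)
  - (∑ k : Fin n, if k ≤ i then cubic n r i k i m P else 0)
  + sumHigh n r i m P
  - sumLow n r i m P
  - (∑ᶠ q : ℤ, aStar n r i i q (bOp n e lam i (m - q) P))
  - ((if r < (i : ℕ) + 1 then (r : ℂ) + 1 else 0)
      + (if (i : ℕ) + 1 ≤ r then ((i : ℕ) : ℂ) + 2 else 0) - γ ^ 2) •
      ((-(m : ℂ)) • aStar n r i i m P)

/-- The mode `ρ(H_i)_m = ℋ_{i,m} ⊗ 1 + 1 ⊗ b_{i,m}`. -/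
noncomputable def rhoH (n r : ℕ) (e : Fin n → Fin n → ℂ) (lam : Fin n → ℂ)
    (i : Fin n) (m : ℤ) (P : PXY n) : PXY n :=
  Hcal n r i m P + bOp n e lam i m P

/-- The mode `ρ(F_i)_m = a_{ii,m} ⊗ 1 + Σ_{j=i+1}^{n} (a_{ij} a*_{i+1,j})_m ⊗ 1`. -/
noncomputable def rhoF (n r : ℕ) (i : Fin n) (m : ℤ) (P : PXY n) : PXY n :=
  aOp n r i i m P + sumF n r i m P

section Commutator

variable {A : Type*} [Ring A]

/-- The commutator in an associative ring. -/
def opComm (a b : A) : A := a * b - b * a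

theorem opComm_skew (a b : A) : opComm a b = -opComm b a := by simp [opComm]

theorem opComm_neg (a b : A) : opComm a (-b) = -opComm a b := by
  simp only [opComm]; noncomm_ring

theorem neg_opComm (a b : A) : opComm (-a) b = -opComm a b := by
  simp only [opComm]; noncomm_ring

theorem add_opComm (a b c : A) : opComm (a + b) c = opComm a c + opComm b c := by
  simp only [opComm]; noncomm_ring

theorem mul_opComm (a b c : A) : opComm (a * b) c = a * opComm b c + opComm a c * b := by
  simp only [opComm]; noncomm_ring

theorem opComm_mul (a b c : A) : opComm a (b * c) = opComm a b * c + b * opComm a c := by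
  simp only [opComm]; noncomm_ring

theorem opComm_jacobi (a b c : A) :
    opComm (opComm a b) c = opComm a (opComm b c) - opComm b (opComm a c) := by
  simp only [opComm]; noncomm_ring

theorem sum_opComm {ι : Type*} (s : Finset ι) (f : ι → A) (b : A) :
    opComm (∑ i ∈ s, f i) b = ∑ i ∈ s, opComm (f i) b := by
  simp [opComm, Finset.sum_mul, Finset.mul_sum]

theorem opComm_sum {ι : Type*} (s : Finset ι) (f : ι → A) (b : A) :
    opComm b (∑ i ∈ s, f i) = ∑ i ∈ s, opComm b (f i) := by
  simp [opComm, Finset.sum_mul, Finset.mul_sum]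

variable [Algebra ℂ A]

theorem smul_opComm (c : ℂ) (a b : A) : opComm (c • a) b = c • opComm a b := by
  simp [opComm, smul_sub]

theorem opComm_smul (c : ℂ) (a b : A) : opComm a (c • b) = c • opComm a b := by
  simp [opComm, smul_sub]

theorem opComm_smul_one (c : ℂ) (a : A) : opComm a (c • 1) = 0 := by
  simp [opComm]

theorem smul_one_opComm (c : ℂ) (a : A) : opComm (c • 1) a = 0 := by
  simp [opComm]

end Commutator

section Polynomial

variable {σ : Type*}

theorem eq_C_of_pderiv_eq_zero {f : MvPolynomial σ ℂ} (h : ∀ v, pderiv v f = 0) :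
    f = C (constantCoeff f) := by
  classical
  ext d
  rw [coeff_C]
  split_ifs with hd
  · subst hd; rfl
  · obtain ⟨v, hv⟩ : ∃ v, d v ≠ 0 := by
      by_contra! hc
      exact hd (Finsupp.ext fun v => (hc v).symm)
    have key := coeff_pderiv (i := v) f (d - Finsupp.single v 1)
    rw [h v, tsub_add_cancel_of_le (by simpa using Nat.one_le_iff_ne_zero.mpr hv),
      coeff_zero] at key
    rcases mul_eq_zero.mp key.symm with h0 | h0
    · exact h0
    · exact absurd h0 (Nat.cast_add_one_ne_zero _)

/-- Multiplication by a variable. -/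
noncomputable abbrev mulX (v : σ) : Module.End ℂ (MvPolynomial σ ℂ) := LinearMap.mulLeft ℂ (X v)

/-- Partial differentiation as a linear operator. -/
noncomputable abbrev partialX (v : σ) : Module.End ℂ (MvPolynomial σ ℂ) :=
  (pderiv v).toLinearMap

theorem opComm_apply {V : Type*} [AddCommGroup V] [Module ℂ V] (S T : Module.End ℂ V) (P : V) :
    opComm S T P = S (T P) - T (S P) := rfl

theorem opComm_mulX_mulX (v w : σ) : opComm (mulX v) (mulX w) = 0 := by
  refine LinearMap.ext fun P => ?_
  simp [opComm_apply, mul_left_comm]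

theorem opComm_partialX_partialX (v w : σ) : opComm (partialX v) (partialX w) = 0 := by
  have h : ⁅(pderiv v : Derivation ℂ (MvPolynomial σ ℂ) (MvPolynomial σ ℂ)),
      (pderiv w : Derivation ℂ (MvPolynomial σ ℂ) (MvPolynomial σ ℂ))⁆ = 0 := by
    classical
    apply derivation_ext
    intro i
    simp only [Derivation.commutator_apply, pderiv_X, Derivation.zero_apply]
    simp only [Pi.single_apply]
    split_ifs <;> simp
  refine LinearMap.ext fun P => ?_
  exact DFunLike.congr_fun h P

theorem opComm_partialX_mulX [DecidableEq σ] (v w : σ) :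
    opComm (partialX v) (mulX w) = if v = w then 1 else 0 := by
  refine LinearMap.ext fun P => ?_
  simp only [opComm_apply, LinearMap.mulLeft_apply, Derivation.coeFn_coe, Derivation.leibniz,
    smul_eq_mul, pderiv_X, Pi.single_apply]
  by_cases h : v = w
  · subst h; simp
  · simp [h, Ne.symm h]

theorem eq_smul_of_opComm_eq_zero {T : Module.End ℂ (MvPolynomial σ ℂ)}
    (hX : ∀ v, opComm T (mulX v) = 0) (hD : ∀ v, opComm T (partialX v) = 0)
    (P : MvPolynomial σ ℂ) :
    T P = constantCoeff (T 1) • P := by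
  have h1 : T 1 = C (constantCoeff (T 1)) := by
    apply eq_C_of_pderiv_eq_zero
    intro v
    have := congrArg (fun S => S 1) (hD v)
    simpa [opComm_apply] using this
  induction P using MvPolynomial.induction_on with
  | C a =>
    have : (C a : MvPolynomial σ ℂ) = a • 1 := by rw [smul_eq_C_mul, mul_one]
    rw [this, map_smul, smul_comm]
    nth_rewrite 1 [h1]
    simp [smul_eq_C_mul]
  | add p q hp hq => rw [map_add, hp, hq, smul_add]
  | mul_X p v hp =>
    have := congrArg (fun S => S p) (hX v)
    simp only [opComm_apply, LinearMap.mulLeft_apply, LinearMap.zero_apply, sub_eq_zero] at this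
    rw [mul_comm, this, hp, mul_smul_comm]

theorem finite_pderiv_ne_zero {ι : Type*} {g : ι → σ} (hg : Function.Injective g)
    (P : MvPolynomial σ ℂ) : {q | pderiv (g q) P ≠ 0}.Finite := by
  refine (P.vars.finite_toSet.preimage hg.injOn).subset fun q hq => ?_
  by_contra h
  exact hq (pderiv_eq_zero_of_notMem_vars h)

end Polynomial

section LocallyFinite

variable {ι V : Type*} [AddCommGroup V] [Module ℂ V]

/-- The sum of a pointwise finitely supported family of operators. -/
noncomputable def sumEnd (t : ι → Module.End ℂ V)
    (ht : ∀ P, (Function.support fun q => t q P).Finite) : Module.End ℂ V where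
  toFun P := ∑ᶠ q, t q P
  map_add' P Q := by simp only [map_add]; exact finsum_add_distrib (ht P) (ht Q)
  map_smul' c P := by simp only [map_smul, RingHom.id_apply]; exact (smul_finsum' c (ht P)).symm

theorem opComm_sumEnd_apply (t : ι → Module.End ℂ V)
    (ht : ∀ P, (Function.support fun q => t q P).Finite) (D : Module.End ℂ V) (P : V) :
    opComm (sumEnd t ht) D P = ∑ᶠ q, opComm (t q) D P := by
  have h : D (∑ᶠ q, t q P) = ∑ᶠ q, D (t q P) := map_finsum D (ht P)
  simp only [opComm_apply]
  rw [finsum_sub_distrib (ht (D P))]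
  · rw [← h]; rfl
  · refine (ht P).subset fun q hq => ?_
    contrapose! hq
    simp only [Function.mem_support, not_not] at hq ⊢
    rw [hq, map_zero]

end LocallyFinite

section Oscillators

variable {n : ℕ} (r : ℕ)

theorem opComm_aOp_aOp (k l k' l' : Fin n) (m m' : ℤ) :
    opComm (aOp n r k l m) (aOp n r k' l' m') = 0 := by
  unfold aOp
  split_ifs with h h' h'
  · exact opComm_partialX_partialX _ _
  · refine (opComm_partialX_mulX _ _).trans (if_neg ?_)
    rintro ⟨⟩
    exact h' h
  · rw [opComm_skew, neg_eq_zero]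
    refine (opComm_partialX_mulX _ _).trans (if_neg ?_)
    rintro ⟨⟩
    exact h h'
  · exact opComm_mulX_mulX _ _

theorem opComm_aStar_aStar (k l k' l' : Fin n) (m m' : ℤ) :
    opComm (aStar n r k l m) (aStar n r k' l' m') = 0 := by
  unfold aStar
  split_ifs with h h' h'
  · exact opComm_mulX_mulX _ _
  · rw [opComm_neg, ← opComm_skew]
    refine (opComm_partialX_mulX _ _).trans (if_neg ?_)
    simp only [Sum.inl.injEq, Prod.mk.injEq, neg_inj]
    rintro ⟨rfl, rfl, rfl⟩
    exact h' h
  · rw [neg_opComm, neg_eq_zero]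
    refine (opComm_partialX_mulX _ _).trans (if_neg ?_)
    simp only [Sum.inl.injEq, Prod.mk.injEq, neg_inj]
    rintro ⟨rfl, rfl, rfl⟩
    exact h h'
  · rw [neg_opComm, opComm_neg, neg_neg]
    exact opComm_partialX_partialX _ _

theorem opComm_aOp_aStar (k l k' l' : Fin n) (m m' : ℤ) :
    opComm (aOp n r k l m) (aStar n r k' l' m') = if k = k' ∧ l = l' ∧ m = -m' then 1 else 0 := by
  unfold aOp aStar
  split_ifs with h h' h₀ h₀ h' h₀ h₀
  · exact (opComm_partialX_mulX _ _).trans (if_pos (by simp [h₀]))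
  · exact (opComm_partialX_mulX _ _).trans (if_neg (by simpa using h₀))
  · obtain ⟨rfl, rfl, rfl⟩ := h₀
    omega
  · rw [opComm_neg, neg_eq_zero]
    exact opComm_partialX_partialX _ _
  · obtain ⟨rfl, rfl, rfl⟩ := h₀
    omega
  · exact opComm_mulX_mulX _ _
  · rw [opComm_neg, ← opComm_skew]
    exact (opComm_partialX_mulX _ _).trans (if_pos (by simp [h₀]))
  · rw [opComm_neg, ← opComm_skew]
    exact (opComm_partialX_mulX _ _).trans (if_neg (by simpa [eq_comm] using h₀))

theorem opComm_aStar_aOp (k l k' l' : Fin n) (m m' : ℤ) :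
    opComm (aStar n r k l m) (aOp n r k' l' m') = if k = k' ∧ l = l' ∧ m = -m' then -1 else 0 := by
  rw [opComm_skew, opComm_aOp_aStar]
  have : (k' = k ∧ l' = l ∧ m' = -m) ↔ (k = k' ∧ l = l' ∧ m = -m') := by
    constructor <;> (rintro ⟨rfl, rfl, rfl⟩; simp)
  simp only [this]
  split_ifs <;> simp

/-- An operator commuting with all oscillators commutes with the variables `x` and the
corresponding partial derivatives. -/
theorem opComm_inl_eq_zero {T : Module.End ℂ (PXY n)}
    (ha : ∀ k l s, opComm T (aOp n r k l s) = 0) (hs : ∀ k l s, opComm T (aStar n r k l s) = 0)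
    (v : Fin n × Fin n × ℤ) :
    opComm T (mulX (Sum.inl v)) = 0 ∧ opComm T (partialX (Sum.inl v)) = 0 := by
  obtain ⟨k, l, s⟩ := v
  have h1 := ha k l s
  have h2 := hs k l (-s)
  unfold aOp at h1
  unfold aStar at h2
  rw [neg_neg] at h2
  by_cases h : 0 ≤ s ∧ (l : ℕ) + 1 ≤ r
  · rw [if_pos h] at h1
    rw [if_pos (by omega)] at h2
    exact ⟨h2, h1⟩
  · rw [if_neg h] at h1
    rw [if_neg (by omega), opComm_neg, neg_eq_zero] at h2
    exact ⟨h1, h2⟩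

end Oscillators

section Currents

variable {n : ℕ} (r : ℕ)

/-- The normally ordered product `:a_{kl,q} a*_{kl,m-q}:`. -/
noncomputable def nordTerm (n r : ℕ) (k l : Fin n) (m q : ℤ) : Module.End ℂ (PXY n) :=
  if 0 ≤ q ∧ (l : ℕ) + 1 ≤ r then aStar n r k l (m - q) * aOp n r k l q
  else aOp n r k l q * aStar n r k l (m - q)

theorem finite_support_nordTerm (k l : Fin n) (m : ℤ) (P : PXY n) :
    (Function.support fun q => nordTerm n r k l m q P).Finite := by
  have h1 : Function.Injective fun q : ℤ => (Sum.inl (k, l, q) : Idx n) := by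
    intro a b h; simpa using h
  have h2 : Function.Injective fun q : ℤ => (Sum.inl (k, l, -(m - q)) : Idx n) := by
    intro a b h; simpa using h
  refine (((finite_pderiv_ne_zero h1 P).union (finite_pderiv_ne_zero h2 P)).union
    (Set.finite_Ico m 0)).subset fun q hq => ?_
  by_contra hc
  simp only [Set.mem_union, Set.mem_ofPred_eq, Set.mem_Ico, not_or, not_not] at hc
  obtain ⟨⟨hc1, hc2⟩, hc3⟩ := hc
  apply hq
  by_cases h : 0 ≤ q ∧ (l : ℕ) + 1 ≤ r
  · have h0 : aOp n r k l q P = 0 := by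
      rw [aOp, if_pos h]; exact hc1
    simp only [nordTerm, if_pos h, Module.End.mul_apply, h0, map_zero]
  · have h0 : aStar n r k l (m - q) P = 0 := by
      rw [aStar, if_neg (by omega), LinearMap.neg_apply, neg_eq_zero]; exact hc2
    simp only [nordTerm, if_neg h, Module.End.mul_apply, h0, map_zero]

/-- The operator `N_{kl,m}` as a linear map. -/
noncomputable def nordEnd (n r : ℕ) (k l : Fin n) (m : ℤ) : Module.End ℂ (PXY n) :=
  sumEnd (nordTerm n r k l m) (finite_support_nordTerm r k l m)

theorem nordEnd_apply (k l : Fin n) (m : ℤ) (P : PXY n) :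
    nordEnd n r k l m P = Nop n r k l m P := by
  refine finsum_congr fun q => ?_
  simp only [nordTerm]
  split_ifs <;> rfl

theorem exists_nordTerm_eq (k l : Fin n) (m q : ℤ) :
    ∃ c : ℂ, nordTerm n r k l m q = aOp n r k l q * aStar n r k l (m - q) + c • 1 := by
  unfold nordTerm
  split_ifs
  · refine ⟨if q = -(m - q) then -1 else 0, ?_⟩
    have := opComm_aStar_aOp r k l k l (m - q) q
    have h' : (m - q = -q) ↔ (q = -(m - q)) := by omega
    simp only [true_and, h', opComm, sub_eq_iff_eq_add] at this
    rw [this, add_comm]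
    congr 1
    split_ifs
    · exact (neg_one_smul ℂ _).symm
    · exact (zero_smul ℂ _).symm
  · exact ⟨0, by simp⟩

theorem nordTerm_opComm (k l : Fin n) (m q : ℤ) (D : Module.End ℂ (PXY n)) :
    opComm (nordTerm n r k l m q) D =
      aOp n r k l q * opComm (aStar n r k l (m - q)) D +
        opComm (aOp n r k l q) D * aStar n r k l (m - q) := by
  obtain ⟨c, hc⟩ := exists_nordTerm_eq r k l m q
  rw [hc, add_opComm, smul_one_opComm, add_zero, mul_opComm]

theorem nordEnd_opComm_eq_zero {k l : Fin n} {m : ℤ} {D : Module.End ℂ (PXY n)}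
    (h : ∀ q, opComm (nordTerm n r k l m q) D = 0) : opComm (nordEnd n r k l m) D = 0 := by
  refine LinearMap.ext fun P => ?_
  rw [nordEnd, opComm_sumEnd_apply]
  simp [h]

theorem nordEnd_opComm_eq {k l : Fin n} {m : ℤ} {D : Module.End ℂ (PXY n)} (q₀ : ℤ)
    (h : ∀ q, q ≠ q₀ → opComm (nordTerm n r k l m q) D = 0) :
    opComm (nordEnd n r k l m) D = opComm (nordTerm n r k l m q₀) D := by
  refine LinearMap.ext fun P => ?_
  rw [nordEnd, opComm_sumEnd_apply, finsum_eq_single _ q₀]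
  intro q hq
  rw [h q hq, LinearMap.zero_apply]

theorem nordEnd_opComm_aOp (k l k' l' : Fin n) (m s : ℤ) :
    opComm (nordEnd n r k l m) (aOp n r k' l' s) =
      if k = k' ∧ l = l' then -aOp n r k' l' (m + s) else 0 := by
  have key : ∀ q, opComm (nordTerm n r k l m q) (aOp n r k' l' s) =
      if k = k' ∧ l = l' ∧ m - q = -s then -aOp n r k l q else 0 := by
    intro q
    rw [nordTerm_opComm, opComm_aOp_aOp, opComm_aStar_aOp, zero_mul, add_zero]
    split_ifs
    · exact mul_neg_one (aOp n r k l q)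
    · exact mul_zero _
  rw [nordEnd_opComm_eq r (m + s), key]
  · split_ifs with h1 h2 h2
    · obtain ⟨rfl, rfl, _⟩ := h1; rfl
    · exact absurd ⟨h1.1, h1.2.1⟩ h2
    · exact absurd ⟨h2.1, h2.2, by omega⟩ h1
    · rfl
  · intro q hq
    rw [key, if_neg]
    omega

theorem nordEnd_opComm_aStar (k l k' l' : Fin n) (m s : ℤ) :
    opComm (nordEnd n r k l m) (aStar n r k' l' s) =
      if k = k' ∧ l = l' then aStar n r k' l' (m + s) else 0 := by
  have key : ∀ q, opComm (nordTerm n r k l m q) (aStar n r k' l' s) =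
      if k = k' ∧ l = l' ∧ q = -s then aStar n r k l (m - q) else 0 := by
    intro q
    rw [nordTerm_opComm, opComm_aStar_aStar, opComm_aOp_aStar]
    split_ifs <;> simp
  rw [nordEnd_opComm_eq r (-s), key]
  · split_ifs with h1 h2 h2
    · obtain ⟨rfl, rfl, _⟩ := h1; rw [sub_neg_eq_add]
    · exact absurd ⟨h1.1, h1.2.1⟩ h2
    · exact absurd ⟨h2.1, h2.2, rfl⟩ h1
    · rfl
  · intro q hq
    rw [key, if_neg]
    omega

theorem opComm_aOp_inr (k l : Fin n) (s : ℤ) (w : Fin n × ℕ+) :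
    opComm (aOp n r k l s) (mulX (Sum.inr w)) = 0 ∧
      opComm (aOp n r k l s) (partialX (Sum.inr w)) = 0 := by
  unfold aOp
  split_ifs
  · exact ⟨(opComm_partialX_mulX _ _).trans (if_neg (by simp)), opComm_partialX_partialX _ _⟩
  · refine ⟨opComm_mulX_mulX _ _, ?_⟩
    rw [opComm_skew, neg_eq_zero]
    exact (opComm_partialX_mulX _ _).trans (if_neg (by simp))

theorem opComm_aStar_inr (k l : Fin n) (s : ℤ) (w : Fin n × ℕ+) :
    opComm (aStar n r k l s) (mulX (Sum.inr w)) = 0 ∧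
      opComm (aStar n r k l s) (partialX (Sum.inr w)) = 0 := by
  unfold aStar
  split_ifs
  · refine ⟨opComm_mulX_mulX _ _, ?_⟩
    rw [opComm_skew, neg_eq_zero]
    exact (opComm_partialX_mulX _ _).trans (if_neg (by simp))
  · rw [neg_opComm, neg_opComm, neg_eq_zero, neg_eq_zero]
    exact ⟨(opComm_partialX_mulX _ _).trans (if_neg (by simp)), opComm_partialX_partialX _ _⟩

theorem nordEnd_opComm_inr (k l : Fin n) (m : ℤ) (w : Fin n × ℕ+) :
    opComm (nordEnd n r k l m) (mulX (Sum.inr w)) = 0 ∧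
      opComm (nordEnd n r k l m) (partialX (Sum.inr w)) = 0 := by
  constructor <;> refine nordEnd_opComm_eq_zero r fun q => ?_ <;> rw [nordTerm_opComm]
  · rw [(opComm_aOp_inr r k l q w).1, (opComm_aStar_inr r k l _ w).1, mul_zero, zero_mul, add_zero]
  · rw [(opComm_aOp_inr r k l q w).2, (opComm_aStar_inr r k l _ w).2, mul_zero, zero_mul, add_zero]

theorem bOp_pos (e : Fin n → Fin n → ℂ) (lam : Fin n → ℂ) (i : Fin n) (s : ℕ+) :
    bOp n e lam i (s : ℕ) =
      ((s : ℕ) : ℂ) • ∑ k, e i k • (partialX (Sum.inr (k, s)) : Module.End ℂ (PXY n)) := by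
  rw [bOp, dif_pos (by exact_mod_cast s.pos)]
  rfl

theorem bOp_neg (e : Fin n → Fin n → ℂ) (lam : Fin n → ℂ) (i : Fin n) (s : ℕ+) :
    bOp n e lam i (-(s : ℕ)) =
      ∑ k, e i k • (mulX (Sum.inr (k, s)) : Module.End ℂ (PXY n)) := by
  have hs := s.pos
  rw [bOp, dif_neg (by omega), dif_pos (by omega)]
  have : (⟨(- -((s : ℕ) : ℤ)).toNat, by omega⟩ : ℕ+) = s := by
    apply PNat.eq
    simp
  exact Finset.sum_congr rfl fun k _ => by rw [this]; rfl

theorem bOp_zero (e : Fin n → Fin n → ℂ) (lam : Fin n → ℂ) (i : Fin n) :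
    bOp n e lam i 0 = lam i • 1 := by
  simp [bOp]

theorem int_cases_pnat (m : ℤ) : m = 0 ∨ (∃ s : ℕ+, m = (s : ℕ)) ∨ ∃ s : ℕ+, m = -(s : ℕ) := by
  rcases lt_trichotomy m 0 with h | h | h
  · exact Or.inr (Or.inr ⟨⟨(-m).toNat, by omega⟩, by simp; omega⟩)
  · exact Or.inl h
  · exact Or.inr (Or.inl ⟨⟨m.toNat, by omega⟩, by simp; omega⟩)

/-- An operator commuting with all `y` variables and their derivatives commutes with `b_{i,m}`. -/
theorem opComm_bOp_eq_zero (e : Fin n → Fin n → ℂ) (lam : Fin n → ℂ) (i : Fin n) (m : ℤ)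
    {T : Module.End ℂ (PXY n)} (hX : ∀ w, opComm T (mulX (Sum.inr w)) = 0)
    (hD : ∀ w, opComm T (partialX (Sum.inr w)) = 0) : opComm T (bOp n e lam i m) = 0 := by
  rcases int_cases_pnat m with rfl | ⟨s, rfl⟩ | ⟨s, rfl⟩
  · rw [bOp_zero, opComm_smul_one]
  · rw [bOp_pos, opComm_smul, opComm_sum]
    simp only [opComm_smul, hD, smul_zero, Finset.sum_const_zero]
  · rw [bOp_neg, opComm_sum]
    simp only [opComm_smul, hX, smul_zero, Finset.sum_const_zero]

theorem sum_partialX_opComm_sum_mulX (u v : Fin n → ℂ) (s t : ℕ+) :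
    opComm (∑ k, u k • (partialX (Sum.inr (k, s)) : Module.End ℂ (PXY n)))
      (∑ k, v k • (mulX (Sum.inr (k, t)) : Module.End ℂ (PXY n))) =
      (if s = t then ∑ k, u k * v k else 0) • 1 := by
  simp only [sum_opComm, opComm_sum, smul_opComm, opComm_smul, opComm_partialX_mulX,
    Sum.inr.injEq, Prod.mk.injEq]
  split_ifs with h
  · simp [h, Finset.sum_smul, smul_smul, mul_comm]
  · simp [h]

theorem bOp_opComm_bOp (e : Fin n → Fin n → ℂ) (lam : Fin n → ℂ) (i j : Fin n) (m p : ℤ) :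
    opComm (bOp n e lam i m) (bOp n e lam j p) =
      (if m + p = 0 then (m : ℂ) * ∑ k, e i k * e j k else 0) • 1 := by
  rcases int_cases_pnat m with rfl | ⟨s, rfl⟩ | ⟨s, rfl⟩
  · simp [bOp_zero, smul_one_opComm]
  · rcases int_cases_pnat p with rfl | ⟨t, rfl⟩ | ⟨t, rfl⟩
    · have := s.ne_zero
      rw [bOp_zero, opComm_smul_one, if_neg (by omega), zero_smul]
    · have := s.pos
      rw [if_neg (by omega), zero_smul]
      simp only [bOp_pos, smul_opComm, opComm_smul, sum_opComm, opComm_sum,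
        opComm_partialX_partialX, smul_zero, Finset.sum_const_zero]
    · rw [bOp_pos, bOp_neg, smul_opComm, sum_partialX_opComm_sum_mulX, smul_smul]
      have : ((s : ℕ) : ℤ) + -((t : ℕ) : ℤ) = 0 ↔ s = t := by
        rw [← PNat.coe_inj]; omega
      simp only [this, mul_ite, mul_zero, Int.cast_natCast]
  · rcases int_cases_pnat p with rfl | ⟨t, rfl⟩ | ⟨t, rfl⟩
    · have := s.ne_zero
      rw [bOp_zero, opComm_smul_one, if_neg (by omega), zero_smul]
    · rw [bOp_pos, bOp_neg, opComm_skew, smul_opComm, sum_partialX_opComm_sum_mulX, smul_smul,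
        ← neg_smul]
      have : -((s : ℕ) : ℤ) + ((t : ℕ) : ℤ) = 0 ↔ t = s := by
        rw [← PNat.coe_inj]; omega
      simp only [this]
      split_ifs with h
      · subst h
        congr 1
        simp [mul_comm (e j _)]
      · simp
    · have := s.pos
      rw [if_neg (by omega), zero_smul]
      simp only [bOp_neg, smul_opComm, opComm_smul, sum_opComm, opComm_sum,
        opComm_mulX_mulX, smul_zero, Finset.sum_const_zero]

end Currents

section CartanCurrents

variable {n : ℕ} (r : ℕ)

/-- The coefficient of `N_{kl,m}` in `ℋ_{i,m}`. -/
noncomputable def rootCoeff (n : ℕ) (i k l : Fin n) : ℂ :=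
  if k ≤ l then (pairRoot n i k l : ℂ) else 0

/-- The operator `ℋ_{i,m}` as a linear map. -/
noncomputable def cartanEnd (n r : ℕ) (i : Fin n) (m : ℤ) : Module.End ℂ (PXY n) :=
  ∑ k : Fin n, ∑ l : Fin n, rootCoeff n i k l • nordEnd n r k l m

theorem cartanEnd_apply_eq_sum (i : Fin n) (m : ℤ) (P : PXY n) :
    cartanEnd n r i m P = ∑ k : Fin n, ∑ l : Fin n, rootCoeff n i k l • nordEnd n r k l m P := by
  simp [cartanEnd, LinearMap.sum_apply]

theorem cartanEnd_apply (i : Fin n) (m : ℤ) (P : PXY n) :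
    cartanEnd n r i m P = Hcal n r i m P := by
  rw [cartanEnd_apply_eq_sum]
  refine Finset.sum_congr rfl fun k _ => Finset.sum_congr rfl fun l _ => ?_
  rw [nordEnd_apply, rootCoeff]
  split_ifs
  · rfl
  · exact zero_smul _ _

theorem cartanEnd_opComm (i : Fin n) (m : ℤ) (D : Module.End ℂ (PXY n)) :
    opComm (cartanEnd n r i m) D =
      ∑ k : Fin n, ∑ l : Fin n, rootCoeff n i k l • opComm (nordEnd n r k l m) D := by
  simp only [cartanEnd, sum_opComm, smul_opComm]

theorem sum_sum_smul_ite {V : Type*} [AddCommGroup V] [Module ℂ V] (c : Fin n → Fin n → ℂ)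
    (k' l' : Fin n) (v : V) :
    ∑ k : Fin n, ∑ l : Fin n, c k l • (if k = k' ∧ l = l' then v else 0) = c k' l' • v := by
  rw [Finset.sum_eq_single k', Finset.sum_eq_single l']
  · simp
  · intro l _ hl; simp [hl]
  · simp
  · intro k _ hk; simp [hk]
  · simp

theorem cartanEnd_opComm_aOp (i k l : Fin n) (m s : ℤ) :
    opComm (cartanEnd n r i m) (aOp n r k l s) = rootCoeff n i k l • -aOp n r k l (m + s) := by
  rw [cartanEnd_opComm]
  simp only [nordEnd_opComm_aOp]
  exact sum_sum_smul_ite _ _ _ _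

theorem cartanEnd_opComm_aStar (i k l : Fin n) (m s : ℤ) :
    opComm (cartanEnd n r i m) (aStar n r k l s) = rootCoeff n i k l • aStar n r k l (m + s) := by
  rw [cartanEnd_opComm]
  simp only [nordEnd_opComm_aStar]
  exact sum_sum_smul_ite _ _ _ _

theorem cartanEnd_opComm_inr (i : Fin n) (m : ℤ) (w : Fin n × ℕ+) :
    opComm (cartanEnd n r i m) (mulX (Sum.inr w)) = 0 ∧
      opComm (cartanEnd n r i m) (partialX (Sum.inr w)) = 0 := by
  rw [cartanEnd_opComm, cartanEnd_opComm]
  constructor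
  · refine Finset.sum_eq_zero fun k _ => Finset.sum_eq_zero fun l _ => ?_
    rw [(nordEnd_opComm_inr r k l m w).1, smul_zero]
  · refine Finset.sum_eq_zero fun k _ => Finset.sum_eq_zero fun l _ => ?_
    rw [(nordEnd_opComm_inr r k l m w).2, smul_zero]

theorem cartanEnd_opComm_bOp (e : Fin n → Fin n → ℂ) (lam : Fin n → ℂ) (i j : Fin n) (m p : ℤ) :
    opComm (cartanEnd n r i m) (bOp n e lam j p) = 0 :=
  opComm_bOp_eq_zero e lam j p (fun w => (cartanEnd_opComm_inr r i m w).1)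
    fun w => (cartanEnd_opComm_inr r i m w).2

theorem opComm_cartanEnd_apply_eq_smul (i j : Fin n) (m p : ℤ) (P : PXY n) :
    opComm (cartanEnd n r i m) (cartanEnd n r j p) P =
      constantCoeff (opComm (cartanEnd n r i m) (cartanEnd n r j p) 1) • P := by
  have ha : ∀ k l s,
      opComm (opComm (cartanEnd n r i m) (cartanEnd n r j p)) (aOp n r k l s) = 0 := by
    intro k l s
    simp only [opComm_jacobi, cartanEnd_opComm_aOp, opComm_smul, opComm_neg, smul_neg, neg_neg,
      smul_smul]
    rw [mul_comm, add_left_comm, sub_self]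
  have hs : ∀ k l s,
      opComm (opComm (cartanEnd n r i m) (cartanEnd n r j p)) (aStar n r k l s) = 0 := by
    intro k l s
    simp only [opComm_jacobi, cartanEnd_opComm_aStar, opComm_smul, smul_smul]
    rw [mul_comm, add_left_comm, sub_self]
  have hz : ∀ T : Module.End ℂ (PXY n), opComm T 0 = 0 := fun T => by simp [opComm]
  refine eq_smul_of_opComm_eq_zero ?_ ?_ P
  · rintro (v | w)
    · exact (opComm_inl_eq_zero r ha hs v).1
    · rw [opComm_jacobi, (cartanEnd_opComm_inr r i m w).1, (cartanEnd_opComm_inr r j p w).1,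
        hz, hz, sub_zero]
  · rintro (v | w)
    · exact (opComm_inl_eq_zero r ha hs v).2
    · rw [opComm_jacobi, (cartanEnd_opComm_inr r i m w).2, (cartanEnd_opComm_inr r j p w).2,
        hz, hz, sub_zero]

theorem partialX_one {σ : Type*} (v : σ) : partialX v 1 = 0 :=
  Derivation.map_one_eq_zero _

theorem nordEnd_one_eq_zero {k l : Fin n} {p : ℤ} (h : 0 ≤ p ∨ ¬ (l : ℕ) + 1 ≤ r) :
    nordEnd n r k l p 1 = 0 := by
  refine finsum_eq_zero_of_forall_eq_zero fun q => ?_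
  unfold nordTerm
  split_ifs with hq
  · rw [Module.End.mul_apply, aOp, if_pos hq]
    exact (congrArg _ (partialX_one _)).trans (map_zero _)
  · rw [Module.End.mul_apply, aStar, if_neg (by omega), LinearMap.neg_apply]
    erw [partialX_one]
    rw [neg_zero, map_zero]

theorem cartanEnd_one_eq_zero (i : Fin n) {p : ℤ} (h : 0 ≤ p) : cartanEnd n r i p 1 = 0 := by
  rw [cartanEnd_apply_eq_sum]
  refine Finset.sum_eq_zero fun k _ => Finset.sum_eq_zero fun l _ => ?_
  rw [nordEnd_one_eq_zero r (Or.inl h), smul_zero]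

theorem constantCoeff_aOp {k l : Fin n} {q : ℤ} (h : ¬ (0 ≤ q ∧ (l : ℕ) + 1 ≤ r)) (P : PXY n) :
    constantCoeff (aOp n r k l q P) = 0 := by
  rw [aOp, if_neg h, LinearMap.mulLeft_apply]
  simp

theorem constantCoeff_aStar {k l : Fin n} {q : ℤ} (h : q ≤ 0 ∧ (l : ℕ) + 1 ≤ r) (P : PXY n) :
    constantCoeff (aStar n r k l q P) = 0 := by
  rw [aStar, if_pos h, LinearMap.mulLeft_apply]
  simp

theorem constantCoeff_nordEnd (k l : Fin n) {m : ℤ} (hm : m ≤ 0) (P : PXY n) :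
    constantCoeff (nordEnd n r k l m P) = 0 := by
  refine (map_finsum constantCoeff (finite_support_nordTerm r k l m P)).trans ?_
  refine finsum_eq_zero_of_forall_eq_zero fun q => ?_
  unfold nordTerm
  split_ifs with hq
  · exact constantCoeff_aStar r (by omega) _
  · exact constantCoeff_aOp r hq _

theorem constantCoeff_cartanEnd (i : Fin n) {m : ℤ} (hm : m ≤ 0) (P : PXY n) :
    constantCoeff (cartanEnd n r i m P) = 0 := by
  rw [cartanEnd_apply_eq_sum]
  simp [map_sum, constantCoeff_nordEnd r _ _ hm, smul_eq_C_mul]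

theorem nordEnd_one_eq_sum {k l : Fin n} {p : ℤ} (hl : (l : ℕ) + 1 ≤ r) :
    nordEnd n r k l p 1 = ∑ q ∈ Finset.Ico p 0, aOp n r k l q (aStar n r k l (p - q) 1) := by
  refine (finsum_eq_sum_of_support_subset (s := Finset.Ico p 0) _ fun q hq => ?_).trans
    (Finset.sum_congr rfl fun q hq => ?_)
  · by_contra hc
    simp only [Finset.coe_Ico, Set.mem_Ico, not_and, not_lt] at hc
    apply hq
    unfold nordTerm
    split_ifs with h
    · rw [Module.End.mul_apply, aOp, if_pos h]
      exact (congrArg _ (partialX_one _)).trans (map_zero _)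
    · rw [Module.End.mul_apply, aStar, if_neg (by omega), LinearMap.neg_apply]
      erw [partialX_one]
      rw [neg_zero, map_zero]
  · rw [Finset.mem_Ico] at hq
    rw [nordTerm, if_neg (by omega), Module.End.mul_apply]

theorem constantCoeff_aOp_aStar_one {k l : Fin n} {s t : ℤ} (ht : t ≤ 0) (hl : (l : ℕ) + 1 ≤ r) :
    constantCoeff (aOp n r k l s (aStar n r k l t 1)) = if s = -t then 1 else 0 := by
  have h := congrArg (fun T => constantCoeff (T 1)) (opComm_aOp_aStar r k l k l s t)
  simp only [opComm, LinearMap.sub_apply, Module.End.mul_apply, map_sub,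
    constantCoeff_aStar r (⟨ht, hl⟩ : t ≤ 0 ∧ (l : ℕ) + 1 ≤ r), sub_zero, true_and] at h
  rw [h]
  split_ifs <;> simp

theorem constantCoeff_cartanEnd_nordEnd (i k l : Fin n) {m p : ℤ} (hm : 0 < m) (hp : p < 0) :
    constantCoeff (cartanEnd n r i m (nordEnd n r k l p 1)) =
      if m + p = 0 ∧ (l : ℕ) + 1 ≤ r then -(m : ℂ) * rootCoeff n i k l else 0 := by
  by_cases hl : (l : ℕ) + 1 ≤ r
  swap
  · rw [nordEnd_one_eq_zero r (Or.inr hl), map_zero, map_zero, if_neg fun h => hl h.2]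
  have key : ∀ q ∈ Finset.Ico p 0,
      constantCoeff (cartanEnd n r i m (aOp n r k l q (aStar n r k l (p - q) 1))) =
        if m + p = 0 then -rootCoeff n i k l else 0 := by
    intro q hq
    rw [Finset.mem_Ico] at hq
    have h := congrArg (fun T => T 1)
      (opComm_mul (cartanEnd n r i m) (aOp n r k l q) (aStar n r k l (p - q)))
    rw [cartanEnd_opComm_aOp, cartanEnd_opComm_aStar] at h
    simp only [opComm, LinearMap.sub_apply, Module.End.mul_apply, LinearMap.add_apply,
      LinearMap.smul_apply, LinearMap.neg_apply, map_smul, cartanEnd_one_eq_zero r i hm.le,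
      map_zero, sub_zero] at h
    rw [h, map_add, smul_eq_C_mul, smul_eq_C_mul, map_mul, map_mul, map_neg,
      constantCoeff_aOp_aStar_one r (by omega) hl, constantCoeff_aOp r (by omega),
      constantCoeff_C]
    have : m + q = -(p - q) ↔ m + p = 0 := by omega
    simp only [this]
    split_ifs <;> simp
  rw [nordEnd_one_eq_sum r hl, map_sum, map_sum, Finset.sum_congr rfl key, Finset.sum_const,
    Int.card_Ico]
  split_ifs with h1 h2 h2
  · obtain rfl : p = -m := by omega
    rw [nsmul_eq_mul, zero_sub, neg_neg, neg_mul, mul_neg, neg_inj]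
    congr 1
    exact_mod_cast Int.toNat_of_nonneg hm.le
  · exact absurd ⟨h1, hl⟩ h2
  · exact absurd h2.1 h1
  · simp

/-- The anomaly of the currents `ℋ_i` and `ℋ_j`. -/
noncomputable def anomaly (n r : ℕ) (i j : Fin n) : ℂ :=
  ∑ k : Fin n, ∑ l : Fin n,
    if (l : ℕ) + 1 ≤ r then rootCoeff n i k l * rootCoeff n j k l else 0

theorem anomaly_comm (n r : ℕ) (i j : Fin n) : anomaly n r i j = anomaly n r j i := by
  simp only [anomaly, mul_comm]

theorem constantCoeff_opComm_cartanEnd_of_pos (i j : Fin n) {m p : ℤ} (hm : 0 < m) (hp : p < 0) :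
    constantCoeff (opComm (cartanEnd n r i m) (cartanEnd n r j p) 1) =
      if m + p = 0 then -(m : ℂ) * anomaly n r i j else 0 := by
  rw [opComm_apply, cartanEnd_one_eq_zero r i hm.le, map_zero, sub_zero,
    cartanEnd_apply_eq_sum r j]
  simp only [map_sum, map_smul]
  simp only [smul_eq_C_mul, map_mul, constantCoeff_C,
    constantCoeff_cartanEnd_nordEnd r i _ _ hm hp]
  split_ifs with h
  · simp only [h, true_and, anomaly, Finset.mul_sum]
    refine Finset.sum_congr rfl fun k _ => Finset.sum_congr rfl fun l _ => ?_
    split_ifs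
    · ring
    · simp
  · simp [h]

theorem opComm_cartanEnd_apply (i j : Fin n) (m p : ℤ) (P : PXY n) :
    opComm (cartanEnd n r i m) (cartanEnd n r j p) P =
      (if m + p = 0 then -(m : ℂ) * anomaly n r i j else 0) • P := by
  rw [opComm_cartanEnd_apply_eq_smul]
  congr 1
  by_cases h1 : 0 ≤ m ∧ 0 ≤ p
  · rw [opComm_apply, cartanEnd_one_eq_zero r i h1.1, cartanEnd_one_eq_zero r j h1.2]
    split_ifs
    · obtain rfl : m = 0 := by omega
      simp
    · simp
  by_cases h2 : m ≤ 0 ∧ p ≤ 0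
  · rw [opComm_apply, map_sub, constantCoeff_cartanEnd r i h2.1, constantCoeff_cartanEnd r j h2.2]
    split_ifs
    · obtain rfl : m = 0 := by omega
      simp
    · simp
  by_cases hm : 0 < m
  · exact constantCoeff_opComm_cartanEnd_of_pos r i j hm (by omega)
  · rw [opComm_skew, LinearMap.neg_apply, map_neg,
      constantCoeff_opComm_cartanEnd_of_pos r j i (by omega) (by omega), anomaly_comm, add_comm p m]
    split_ifs with h
    · obtain rfl : p = -m := by omega
      simp
    · simp

end CartanCurrents

section RootSums

theorem pair_sum_identity {R : Type*} [CommRing R] (u v : ℕ → R) (N : ℕ) :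
    ∑ b ∈ Finset.range N, ∑ a ∈ Finset.range b, (u a - u b) * (v a - v b) =
      N * ∑ a ∈ Finset.range N, u a * v a -
        (∑ a ∈ Finset.range N, u a) * ∑ a ∈ Finset.range N, v a := by
  induction N with
  | zero => simp
  | succ N ih =>
    have h : ∑ a ∈ Finset.range N, (u a - u N) * (v a - v N) =
        ∑ a ∈ Finset.range N, u a * v a - (∑ a ∈ Finset.range N, u a) * v N -
          u N * ∑ a ∈ Finset.range N, v a + N * (u N * v N) := by
      simp only [sub_mul, mul_sub, Finset.sum_sub_distrib, Finset.sum_mul, Finset.mul_sum,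
        Finset.sum_const, Finset.card_range, nsmul_eq_mul]
      ring
    simp only [Finset.sum_range_succ _ N, ih, h]
    push_cast
    ring

/-- The coordinates of the simple root `ε_i - ε_{i+1}`. -/
def simpleCoord (i a : ℕ) : ℂ := (if a = i then 1 else 0) - if a = i + 1 then 1 else 0

theorem cartan_eq_simpleCoord {n : ℕ} (i s : Fin n) :
    (cartan n i s : ℂ) = simpleCoord i s - simpleCoord i (s + 1) := by
  unfold cartan simpleCoord
  simp only [Fin.ext_iff]
  split_ifs <;> first | omega | norm_num

theorem pairRoot_eq_simpleCoord {n : ℕ} (i : Fin n) {k l : Fin n} (h : k ≤ l) :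
    (pairRoot n i k l : ℂ) = simpleCoord i k - simpleCoord i (l + 1) := by
  unfold pairRoot
  push_cast
  simp only [cartan_eq_simpleCoord]
  refine (Finset.sum_map (Finset.Icc k l) Fin.valEmbedding
    fun s => simpleCoord (i : ℕ) s - simpleCoord i (s + 1)).symm.trans ?_
  rw [Fin.map_valEmbedding_Icc, ← Finset.Ico_add_one_right_eq_Icc]
  rw [← neg_inj, ← Finset.sum_neg_distrib]
  simp only [neg_sub]
  exact Finset.sum_Ico_sub _ (by have := Fin.le_def.mp h; omega)

theorem sum_univ_ite_eq_sum_range {M : Type*} [AddCommMonoid M] {n r : ℕ} (hr : r ≤ n)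
    (f : ℕ → ℕ → M) :
    (∑ l : Fin n, ∑ k : Fin n,
        if (l : ℕ) + 1 ≤ r then if (k : ℕ) ≤ l then f k l else 0 else 0) =
      ∑ b ∈ Finset.range r, ∑ a ∈ Finset.range (b + 1), f a b := by
  rw [Fin.sum_univ_eq_sum_range
    (fun b => ∑ k : Fin n, if b + 1 ≤ r then if (k : ℕ) ≤ b then f k b else 0 else 0) n]
  refine (Finset.sum_subset (Finset.range_subset_range.mpr hr) fun b _ hb => ?_).symm.trans
    (Finset.sum_congr rfl fun b hb => ?_)
  · rw [Finset.mem_range] at hb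
    exact Finset.sum_eq_zero fun k _ => if_neg (by omega)
  · rw [Finset.mem_range] at hb
    rw [Fin.sum_univ_eq_sum_range
      (fun a => if b + 1 ≤ r then if a ≤ b then f a b else 0 else 0) n]
    refine (Finset.sum_subset (Finset.range_subset_range.mpr (by omega))
      fun a _ ha => ?_).symm.trans (Finset.sum_congr rfl fun a ha => ?_)
    · rw [Finset.mem_range] at ha
      rw [if_pos (by omega), if_neg (by omega)]
    · rw [Finset.mem_range] at ha
      rw [if_pos (by omega), if_pos (by omega)]

theorem anomaly_eq_sum {n r : ℕ} (hr : r ≤ n) (i j : Fin n) :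
    anomaly n r i j = ∑ b ∈ Finset.range (r + 1), ∑ a ∈ Finset.range b,
      (simpleCoord i a - simpleCoord i b) * (simpleCoord j a - simpleCoord j b) := by
  have h : ∀ k l : Fin n,
      (if (l : ℕ) + 1 ≤ r then rootCoeff n i k l * rootCoeff n j k l else 0) =
        (fun a b : ℕ => if b + 1 ≤ r then if a ≤ b then
          (simpleCoord i a - simpleCoord i (b + 1)) * (simpleCoord j a - simpleCoord j (b + 1))
          else 0 else 0) k l := by
    intro k l
    by_cases hkl : k ≤ l
    · simp only [rootCoeff, if_pos hkl, pairRoot_eq_simpleCoord _ hkl, if_pos (Fin.le_def.mp hkl)]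
    · simp only [rootCoeff, if_neg hkl, if_neg (fun hc => hkl (Fin.le_def.mpr hc)), mul_zero]
  simp only [anomaly, h]
  rw [Finset.sum_comm, Finset.sum_range_succ', Finset.range_zero, Finset.sum_empty, add_zero]
  exact sum_univ_ite_eq_sum_range hr fun a b =>
    (simpleCoord i a - simpleCoord i (b + 1)) * (simpleCoord j a - simpleCoord j (b + 1))

theorem sum_simpleCoord (i r : ℕ) :
    ∑ a ∈ Finset.range (r + 1), simpleCoord i a = if i = r then 1 else 0 := by
  simp only [simpleCoord, Finset.sum_sub_distrib, Finset.sum_ite_eq', Finset.mem_range]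
  split_ifs <;> first | omega | norm_num

theorem sum_simpleCoord_mul (i j r : ℕ) :
    ∑ a ∈ Finset.range (r + 1), simpleCoord i a * simpleCoord j a =
      (if i < r + 1 then simpleCoord j i else 0) - if i < r then simpleCoord j (i + 1) else 0 := by
  have : ∀ a, simpleCoord i a * simpleCoord j a =
      (if a = i then simpleCoord j a else 0) - if a = i + 1 then simpleCoord j a else 0 := by
    intro a
    rw [simpleCoord, sub_mul, ite_mul, ite_mul, one_mul, zero_mul]
  simp only [this, Finset.sum_sub_distrib, Finset.sum_ite_eq', Finset.mem_range,
    Nat.add_lt_add_iff_right]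

theorem Bmat_sub_anomaly {n r : ℕ} (hr : r ≤ n) (γ : ℂ) (i j : Fin n) :
    Bmat n r γ i j - anomaly n r i j = (cartan n i j : ℂ) * (γ ^ 2 - ((r : ℂ) + 1)) := by
  rw [anomaly_eq_sum hr, pair_sum_identity, sum_simpleCoord, sum_simpleCoord, sum_simpleCoord_mul]
  unfold Bmat cartan simpleCoord
  simp only [Fin.ext_iff]
  push_cast
  split_ifs <;> first | omega | ring

end RootSums

/-- R1: `[ρ(H_i)_m, ρ(H_j)_p] = (α_i|α_j)(γ²−(r+1)) m δ_{m+p,0} id`. -/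
theorem wakimoto_R1 (n r : ℕ) (hn : 1 ≤ n) (hr : r ≤ n)
    (γ : ℂ) (hγ : γ ≠ 0) (e : Fin n → Fin n → ℂ) (lam : Fin n → ℂ)
    (he : ∀ i j, ∑ k, e i k * e j k = Bmat n r γ i j)
    (i j : Fin n) (m p : ℤ) (P : PXY n) :
    rhoH n r e lam i m (rhoH n r e lam j p P) - rhoH n r e lam j p (rhoH n r e lam i m P) =
      ((cartan n i j : ℂ) * (γ ^ 2 - ((r : ℂ) + 1)) * (m : ℂ) *
        (if m + p = 0 then 1 else 0)) • P := by
  have hrho : ∀ i m P, rhoH n r e lam i m P = (cartanEnd n r i m + bOp n e lam i m) P := by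
    intro i m P
    rw [rhoH, LinearMap.add_apply, cartanEnd_apply]
  simp only [hrho]
  rw [← opComm_apply, add_opComm, opComm_skew _ (_ + _), opComm_skew (bOp n e lam i m),
    add_opComm, add_opComm, cartanEnd_opComm_bOp, opComm_skew (bOp n e lam j p) (cartanEnd n r i m),
    cartanEnd_opComm_bOp, neg_zero, add_zero, zero_add, ← opComm_skew, ← opComm_skew,
    bOp_opComm_bOp, LinearMap.add_apply, opComm_cartanEnd_apply, LinearMap.smul_apply,
    Module.End.one_apply, ← add_smul, he, ← Bmat_sub_anomaly hr]
  congr 1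
  split_ifs <;> ring
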